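/- Braid relation (type B2): if the Cartan integers are c_α(β) = −1 and c_β(α) = −2, then the Demazure operators satisfy the length-four braid relation: δ_α(δ_β(δ_α(δ_β(u)))) = δ_β(δ_α(δ_β(δ_α(u)))) for every u ∈ ℤ[M]. -/

import Mathlib

open AddMonoidAlgebra

noncomputable section

/-- The reflection `λ ↦ λ - c(λ) • α` associated to a root `α` and coroot `c`,
as an additive homomorphism of the weight lattice `M`. -/
def demazureReflection {M : Type*} [AddCommGroup M] (α : M) (c : M →+ ℤ) : M →+ M where
  toFun := fun lam => lam - c lam • α
  map_zero' := by simp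
  map_add' := fun x y => by simp only [map_add, add_smul]; abel

/-- The ring endomorphism of the group algebra `ℤ[M]` induced by the reflection
`s(λ) = λ - c(λ)·α`; it sends `e^λ` to `e^{s(λ)}`. -/
def demazureReflectionAlg {M : Type*} [AddCommGroup M] (α : M) (c : M →+ ℤ) :
    AddMonoidAlgebra ℤ M →+* AddMonoidAlgebra ℤ M :=
  mapDomainRingHom ℤ (demazureReflection α c)

/-- The Weyl numerator identity for `δα δβ δα δβ` in type `B₂`, where `a = e^{-α}`, `b = e^{-β}`,
with inverses `a'`, `b'`, and `A`, `B` play the role of the reflections. -/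
theorem demazure_B2_weyl_formula_alpha {R : Type*} [CommRing R] [IsDomain R]
    (A B : R →+* R) (a b a' b' : R) (haa : a * a' = 1) (hbb : b * b' = 1)
    (hAa : A a = a') (hAb : A b = a * b) (hBa : B a = a * b ^ 2) (hBb : B b = b')
    (hAA : ∀ x, A (A x) = x) (hBB : ∀ x, B (B x) = x)
    (ha : 1 - a ≠ 0) (hb : 1 - b ≠ 0)
    (δα δβ : R → R) (hδα : ∀ u, (1 - a) * δα u = u - a * A u)
    (hδβ : ∀ u, (1 - b) * δβ u = u - b * B u) (u : R) :
    (1 - a) * (1 - b) * (1 - a * b) * (1 - a * b ^ 2) * δα (δβ (δα (δβ u))) =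
      u - b * B u - a * A u + a ^ 2 * b * A (B u) + a * b ^ 3 * B (A u)
        - a ^ 2 * b ^ 4 * B (A (B u)) - a ^ 3 * b ^ 3 * A (B (A u))
        + a ^ 3 * b ^ 4 * A (B (A (B u))) := by
  have h1 := hδβ u
  set v1 := δβ u
  have hA1 := congrArg A h1
  simp only [map_mul, map_sub, map_one, hAb] at hA1
  have h2 : (1 - a) * (1 - b) * (1 - a * b) * δα v1 =
      (1 - a * b) * (u - b * B u) - a * (1 - b) * (A u - a * b * A (B u)) := by
    linear_combination (1 - b) * (1 - a * b) * hδα v1 + (1 - a * b) * h1 - a * (1 - b) * hA1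
  set v2 := δα v1
  have hB2 := congrArg B h2
  simp only [map_mul, map_sub, map_one, hBa, hBb, hBB] at hB2
  have hBab : a * b ^ 2 * b' = a * b := by linear_combination a * b * hbb
  rw [hBab] at hB2
  have hB2_neg : -((1 - a * b ^ 2) * (1 - b) * (1 - a * b) * B v2) =
      (1 - a * b) * (b * B u - u) + a * b ^ 2 * (1 - b) * (B (A u) - a * b * B (A (B u))) := by
    linear_combination b * hB2 + ((1 - a * b ^ 2) * (1 - a * b) * B v2 - (1 - a * b) * u
      + a * b ^ 2 * (B (A u) - a * b * B (A (B u)))) * hbb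
  have h3 : (1 - a) * (1 - b) * (1 - a * b) * (1 - a * b ^ 2) * δβ v2 =
      (1 - a ^ 2 * b ^ 2) * (u - b * B u) - a * (1 - a * b ^ 2) * (A u - a * b * A (B u))
        + a * b ^ 3 * (1 - a) * (B (A u) - a * b * B (A (B u))) := by
    apply mul_left_cancel₀ hb
    linear_combination (1 - a) * (1 - b) * (1 - a * b) * (1 - a * b ^ 2) * hδβ v2
      + (1 - a * b ^ 2) * h2 + b * (1 - a) * hB2_neg
  set v3 := δβ v2
  have hA3 := congrArg A h3
  have hAab : a' * (a * b) = b := by linear_combination b * haa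
  have hAab2 : a' * (a * b) ^ 2 = a * b ^ 2 := by linear_combination a * b ^ 2 * haa
  have hAa2b2 : a' ^ 2 * (a * b) ^ 2 = b ^ 2 := by
    linear_combination b ^ 2 * (a * a' + 1) * haa
  have hAab3 : a' * (a * b) ^ 3 = a ^ 2 * b ^ 3 := by linear_combination a ^ 2 * b ^ 3 * haa
  simp only [map_mul, map_sub, map_add, map_pow, map_one, hAa, hAb, hAA, hAab, hAab2, hAa2b2,
    hAab3] at hA3
  have hA3_neg : -((1 - a) * (1 - b) * (1 - a * b) * (1 - a * b ^ 2) * A v3) =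
      a * (1 - b ^ 2) * (A u - a * b * A (B u)) - (1 - a * b ^ 2) * (u - b * B u)
        - a ^ 2 * b ^ 3 * (1 - a) * (A (B (A u)) - b * A (B (A (B u)))) := by
    linear_combination a * hA3 + ((1 - a * b) * (1 - b) * (1 - a * b ^ 2) * A v3
      - (1 - a * b ^ 2) * (u - b * B u)
      - a ^ 2 * b ^ 3 * (A (B (A u)) - b * A (B (A (B u))))) * haa
  apply mul_left_cancel₀ ha
  linear_combination (1 - a) * (1 - b) * (1 - a * b) * (1 - a * b ^ 2) * hδα v3 + h3 + a * hA3_neg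

/-- The Weyl numerator identity for `δβ δα δβ δα` in type `B₂`; compare
`demazure_B2_weyl_formula_alpha`. -/
theorem demazure_B2_weyl_formula_beta {R : Type*} [CommRing R] [IsDomain R]
    (A B : R →+* R) (a b a' b' : R) (haa : a * a' = 1) (hbb : b * b' = 1)
    (hAa : A a = a') (hAb : A b = a * b) (hBa : B a = a * b ^ 2) (hBb : B b = b')
    (hAA : ∀ x, A (A x) = x) (hBB : ∀ x, B (B x) = x)
    (ha : 1 - a ≠ 0) (hb : 1 - b ≠ 0)
    (δα δβ : R → R) (hδα : ∀ u, (1 - a) * δα u = u - a * A u)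
    (hδβ : ∀ u, (1 - b) * δβ u = u - b * B u) (u : R) :
    (1 - a) * (1 - b) * (1 - a * b) * (1 - a * b ^ 2) * δβ (δα (δβ (δα u))) =
      u - b * B u - a * A u + a ^ 2 * b * A (B u) + a * b ^ 3 * B (A u)
        - a ^ 2 * b ^ 4 * B (A (B u)) - a ^ 3 * b ^ 3 * A (B (A u))
        + a ^ 3 * b ^ 4 * B (A (B (A u))) := by
  have h1 := hδα u
  set v1 := δα u
  have hB1 := congrArg B h1
  simp only [map_mul, map_sub, map_one, hBa] at hB1
  have h2 : (1 - a) * (1 - b) * (1 - a * b ^ 2) * δβ v1 =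
      (1 - a * b ^ 2) * (u - a * A u) - b * (1 - a) * (B u - a * b ^ 2 * B (A u)) := by
    linear_combination (1 - a) * (1 - a * b ^ 2) * hδβ v1 + (1 - a * b ^ 2) * h1
      - b * (1 - a) * hB1
  set v2 := δβ v1
  have hA2 := congrArg A h2
  have hAab2 : a' * (a * b) ^ 2 = a * b ^ 2 := by linear_combination a * b ^ 2 * haa
  simp only [map_mul, map_sub, map_pow, map_one, hAa, hAb, hAA, hAab2] at hA2
  have hA2_neg : -((1 - a) * (1 - a * b) * (1 - a * b ^ 2) * A v2) =
      (1 - a * b ^ 2) * (a * A u - u)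
        + a * b * (1 - a) * (A (B u) - a * b ^ 2 * A (B (A u))) := by
    linear_combination a * hA2 + ((1 - a * b) * (1 - a * b ^ 2) * A v2 - (1 - a * b ^ 2) * u
      + a * b * (A (B u) - a * b ^ 2 * A (B (A u)))) * haa
  have h3 : (1 - a) * (1 - b) * (1 - a * b) * (1 - a * b ^ 2) * δα v2 =
      (1 - a * b ^ 2) * (u - a * A u) - b * (1 - a * b) * (B u - a * b ^ 2 * B (A u))
        + a ^ 2 * b * (1 - b) * (A (B u) - a * b ^ 2 * A (B (A u))) := by
    apply mul_left_cancel₀ ha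
    linear_combination (1 - a) * (1 - b) * (1 - a * b) * (1 - a * b ^ 2) * hδα v2
      + (1 - a * b) * h2 + a * (1 - b) * hA2_neg
  set v3 := δα v2
  have hB3 := congrArg B h3
  have hBab : a * b ^ 2 * b' = a * b := by linear_combination a * b * hbb
  have hBab2 : a * b ^ 2 * b' ^ 2 = a := by linear_combination a * (b * b' + 1) * hbb
  have hBa2b : (a * b ^ 2) ^ 2 * b' = a ^ 2 * b ^ 3 := by
    linear_combination a ^ 2 * b ^ 3 * hbb
  simp only [map_mul, map_sub, map_add, map_pow, map_one, hBa, hBb, hBB, hBab, hBab2, hBa2b]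
    at hB3
  have hB3_neg : -((1 - a) * (1 - b) * (1 - a * b) * (1 - a * b ^ 2) * B v3) =
      b * (1 - a) * (B u - a * b ^ 2 * B (A u)) - (1 - a * b) * (u - a * A u)
        - a ^ 2 * b ^ 3 * (1 - b) * (B (A (B u)) - a * B (A (B (A u)))) := by
    linear_combination b * hB3 + ((1 - a) * (1 - a * b) * (1 - a * b ^ 2) * B v3
      - (1 - a * b) * (u - a * A u)
      - a ^ 2 * b ^ 3 * (B (A (B u)) - a * B (A (B (A u))))) * hbb
  apply mul_left_cancel₀ hb
  linear_combination (1 - a) * (1 - b) * (1 - a * b) * (1 - a * b ^ 2) * hδβ v3 + h3 + b * hB3_neg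

theorem demazureReflectionAlg_single {M : Type*} [AddCommGroup M] (α : M) (c : M →+ ℤ)
    (x : M) (n : ℤ) :
    demazureReflectionAlg α c (single x n) = single (x - c x • α) n := by
  simp [demazureReflectionAlg, demazureReflection]

theorem demazureReflectionAlg_comp {M : Type*} [AddCommGroup M] (α β : M) (c d : M →+ ℤ) :
    (demazureReflectionAlg α c).comp (demazureReflectionAlg β d) =
      mapDomainRingHom ℤ ((demazureReflection α c).comp (demazureReflection β d)) := by
  ext x <;> simp [demazureReflectionAlg]

theorem demazureReflectionAlg_involutive {M : Type*} [AddCommGroup M] (α : M) (c : M →+ ℤ)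
    (hc : c α = 2) (u : AddMonoidAlgebra ℤ M) :
    demazureReflectionAlg α c (demazureReflectionAlg α c u) = u := by
  have h : (demazureReflection α c).comp (demazureReflection α c) = AddMonoidHom.id M := by
    ext x
    simp only [demazureReflection, AddMonoidHom.comp_apply, AddMonoidHom.coe_mk,
      ZeroHom.coe_mk, map_sub, map_zsmul, hc, AddMonoidHom.id_apply]
    module
  have := DFunLike.congr_fun (demazureReflectionAlg_comp α α c c) u
  rw [h] at this
  simpa using this

theorem demazureReflectionAlg_braid_B2 {M : Type*} [AddCommGroup M] (α β : M)
    (cα cβ : M →+ ℤ) (hcα : cα α = 2) (hcβ : cβ β = 2) (h1 : cα β = -1) (h2 : cβ α = -2)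
    (u : AddMonoidAlgebra ℤ M) :
    demazureReflectionAlg α cα (demazureReflectionAlg β cβ
      (demazureReflectionAlg α cα (demazureReflectionAlg β cβ u))) =
    demazureReflectionAlg β cβ (demazureReflectionAlg α cα
      (demazureReflectionAlg β cβ (demazureReflectionAlg α cα u))) := by
  induction u using AddMonoidAlgebra.induction_linear with
  | zero => simp
  | add f g hf hg => simp only [map_add, hf, hg]
  | single x n =>
    simp only [demazureReflectionAlg_single, map_sub, map_zsmul, hcα, hcβ, h1, h2, smul_eq_mul]
    congr 1
    module

theorem one_sub_single_ne_zero {M : Type*} [AddCommGroup M] {x : M} (hx : x ≠ 0) :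
    (1 : AddMonoidAlgebra ℤ M) - single x 1 ≠ 0 := by
  rw [one_def, sub_ne_zero]
  exact fun h => hx (single_left_injective one_ne_zero h).symm

/-- Braid relation in type B2: if cα(β) = -1 and cβ(α) = -2 then
δα δβ δα δβ = δβ δα δβ δα. -/
theorem demazure_braid_B2 {M : Type*} [AddCommGroup M]
    [Module.Free ℤ M] [Module.Finite ℤ M]
    (α β : M) (hαβ : LinearIndependent ℤ ![α, β])
    (cα cβ : M →+ ℤ) (hcα : cα α = 2) (hcβ : cβ β = 2)
    (δα δβ : AddMonoidAlgebra ℤ M →ₗ[ℤ] AddMonoidAlgebra ℤ M)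
    (hδα : ∀ u : AddMonoidAlgebra ℤ M,
      (1 - single (-α) 1) * δα u = u - single (-α) 1 * demazureReflectionAlg α cα u)
    (hδβ : ∀ u : AddMonoidAlgebra ℤ M,
      (1 - single (-β) 1) * δβ u = u - single (-β) 1 * demazureReflectionAlg β cβ u)
    (h1 : cα β = -1) (h2 : cβ α = -2) :
    ∀ u : AddMonoidAlgebra ℤ M, δα (δβ (δα (δβ u))) = δβ (δα (δβ (δα u))) := by
  intro u
  have hne : ∀ m n : ℤ, m ≠ 0 ∨ n ≠ 0 → m • α + n • β ≠ 0 := fun m n h h0 => by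
    obtain ⟨hm, hn⟩ := LinearIndependent.pair_iff.mp hαβ m n h0
    exact h.elim (· hm) (· hn)
  have : TwoUniqueSums M := TwoUniqueSums.of_injective_addHom
    (Module.Free.chooseBasis ℤ M).repr.toAddMonoidHom.toAddHom
    (Module.Free.chooseBasis ℤ M).repr.injective inferInstance
  have hα : (1 : AddMonoidAlgebra ℤ M) - single (-α) 1 ≠ 0 :=
    one_sub_single_ne_zero (by simpa using hne 1 0 (by simp))
  have hβ : (1 : AddMonoidAlgebra ℤ M) - single (-β) 1 ≠ 0 :=
    one_sub_single_ne_zero (by simpa using hne 0 1 (by simp))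
  have hab : (1 : AddMonoidAlgebra ℤ M) - single (-α) 1 * single (-β) 1 ≠ 0 := by
    rw [single_mul_single, one_mul]
    refine one_sub_single_ne_zero fun h => hne (-1) (-1) (by simp) ?_
    rw [← h]
    module
  have hab2 : (1 : AddMonoidAlgebra ℤ M) - single (-α) 1 * single (-β) 1 ^ 2 ≠ 0 := by
    rw [single_pow, single_mul_single, one_pow, one_mul]
    refine one_sub_single_ne_zero fun h => hne (-1) (-2) (by simp) ?_
    rw [← h]
    module
  have haa : (single (-α) 1 * single α 1 : AddMonoidAlgebra ℤ M) = 1 := by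
    simp [single_mul_single, one_def]
  have hbb : (single (-β) 1 * single β 1 : AddMonoidAlgebra ℤ M) = 1 := by
    simp [single_mul_single, one_def]
  have hAa : demazureReflectionAlg α cα (single (-α) 1) = single α 1 := by
    rw [demazureReflectionAlg_single, map_neg, hcα]
    congr 1
    module
  have hBb : demazureReflectionAlg β cβ (single (-β) 1) = single β 1 := by
    rw [demazureReflectionAlg_single, map_neg, hcβ]
    congr 1
    module
  have hAb : demazureReflectionAlg α cα (single (-β) 1) = single (-α) 1 * single (-β) 1 := by
    rw [demazureReflectionAlg_single, map_neg, h1, single_mul_single, one_mul]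
    congr 1
    module
  have hBa : demazureReflectionAlg β cβ (single (-α) 1) =
      single (-α) 1 * single (-β) 1 ^ 2 := by
    rw [demazureReflectionAlg_single, map_neg, h2, single_pow, single_mul_single, one_pow,
      one_mul]
    congr 1
    module
  have hAA := demazureReflectionAlg_involutive α cα hcα
  have hBB := demazureReflectionAlg_involutive β cβ hcβ
  apply mul_left_cancel₀ (mul_ne_zero (mul_ne_zero (mul_ne_zero hα hβ) hab) hab2)
  rw [demazure_B2_weyl_formula_alpha _ _ _ _ _ _ haa hbb hAa hAb hBa hBb hAA hBB hα hβ
      δα δβ hδα hδβ,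
    demazure_B2_weyl_formula_beta _ _ _ _ _ _ haa hbb hAa hAb hBa hBb hAA hBB hα hβ
      δα δβ hδα hδβ,
    demazureReflectionAlg_braid_B2 α β cα cβ hcα hcβ h1 h2]
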